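/- Let α be a real number with α − max G ∉ {0, −1, −2, …} and assume Ω_G(n) ≠ 0 for every integer n ≥ 0. Then there do not exist real sequences (a_n)_{n≥0}, (b_n)_{n≥0}, (c_n)_{n≥0} with c_n ≠ 0 for all n ≥ 1 such that x·q_n(x) = a_n·q_{n+1}(x) + b_n·q_n(x) + c_n·q_{n−1}(x) for all n ≥ 0 (with the convention q_{−1} = 0); i.e., the sequence (q_n)_n never satisfies a three-term recurrence relation of this form. -/

import Mathlib

open Polynomial Finset

/-- Pochhammer symbol `(a)_l = a (a+1) ⋯ (a+l-1)`, with `(a)_0 = 1`. -/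
noncomputable def poch (a : ℝ) (l : ℕ) : ℝ := ∏ t ∈ Finset.range l, (a + t)

/-- Generalized binomial coefficient `binom (n+α, n−j) = (α+j+1)⋯(α+n)/(n−j)!`. -/
noncomputable def genBinom (α : ℝ) (n j : ℕ) : ℝ :=
  (∏ t ∈ Finset.Ico (j + 1) (n + 1), (α + t)) / (Nat.factorial (n - j) : ℝ)

/-- Laguerre polynomial `L_n^α(x) = Σ_{j=0}^n ((−x)^j/j!)·binom(n+α, n−j)`. -/
noncomputable def laguerre (α : ℝ) (n : ℕ) : Polynomial ℝ :=
  ∑ j ∈ Finset.range (n + 1),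
    Polynomial.C ((-1 : ℝ) ^ j / (Nat.factorial j : ℝ) * genBinom α n j) * Polynomial.X ^ j

/-- Laguerre polynomials indexed by `ℤ`, with the convention `L_u^α = 0` for `u < 0`. -/
noncomputable def laguerreZ (α : ℝ) (n : ℤ) : Polynomial ℝ :=
  if n < 0 then 0 else laguerre α n.toNat

/-- The polynomial `binom (x+l, l) = (x+1)(x+2)⋯(x+l)/l!`. -/
noncomputable def binomPoly (l : ℕ) : Polynomial ℝ :=
  Polynomial.C ((Nat.factorial l : ℝ)⁻¹) *
    ∏ t ∈ Finset.range l, (Polynomial.X + Polynomial.C ((t : ℝ) + 1))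

/-- The Casoratian `Ω_G(x) = det (R_{g_l}(x−j))_{l,j=1,…,m}`. -/
noncomputable def casoratian {m : ℕ} (R : Fin m → Polynomial ℝ) (x : ℝ) : ℝ :=
  Matrix.det (Matrix.of fun l j : Fin m => (R l).eval (x - ((j : ℕ) + 1)))

/-- The maximum of the finite set `G` (given by the values of `g`). -/
noncomputable def Gmax {m : ℕ} (g : Fin m → ℕ) : ℕ := Finset.univ.sup g

/-- The polynomial `q_n`, defined as an `(m+1)×(m+1)` determinant whose first row is
`(L_n^α(x), …, L_{n−m}^α(x))` and whose `(h+1)`-th row is `(R_{g_h}(n), …, R_{g_h}(n−m))`. -/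
noncomputable def qpoly (α : ℝ) {m : ℕ} (R : Fin m → Polynomial ℝ) (n : ℤ) : Polynomial ℝ :=
  Matrix.det (Matrix.of fun i j : Fin (m + 1) =>
    if h : (i : ℕ) = 0 then laguerreZ α (n - (j : ℕ))
    else Polynomial.C ((R ⟨(i : ℕ) - 1, by have := i.isLt; omega⟩).eval ((n : ℝ) - ((j : ℕ) : ℝ))))

/-- `q_n` extended by the convention `q_k = 0` for `k < 0`. -/
noncomputable def qZ (α : ℝ) {m : ℕ} (R : Fin m → Polynomial ℝ) (n : ℤ) : Polynomial ℝ :=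
  if n < 0 then 0 else qpoly α R n

/-- `momFun β p k = L_β(p(x)·x^k)`, where `L_β` is the moment functional on Laurent
polynomials determined by `L_β(x^j) = Γ(β+j+1)`. -/
noncomputable def momFun (β : ℝ) (p : Polynomial ℝ) (k : ℤ) : ℝ :=
  ∑ t ∈ Finset.range (p.natDegree + 1), p.coeff t * Real.Gamma (β + t + k + 1)

/-- The bilinear form `⟨p, q⟩ = L_{α−m}(p·q) + Σ_{i=0}^{m−1} (q^{(i)}(0)/i!)·L_α(p·U_i)`,
where `U_i(x) = Σ_{g∈G} ( −x^{i−m}/m + κ_i^g·Σ_{l=0}^g (α−l)_l w_l^g x^{−l−1} )`. -/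
noncomputable def bilin (α : ℝ) {m : ℕ} (g : Fin m → ℕ) (κ : ℕ → Fin m → ℝ)
    (w : Fin m → ℕ → ℝ) (p q : Polynomial ℝ) : ℝ :=
  momFun (α - m) (p * q) 0 +
    ∑ i ∈ Finset.range m,
      (Polynomial.eval 0 (Polynomial.derivative^[i] q) / (Nat.factorial i : ℝ)) *
        (∑ h : Fin m,
          (-(1 / (m : ℝ)) * momFun α p ((i : ℤ) - (m : ℤ)) +
            κ i h * ∑ l ∈ Finset.range (g h + 1),
              poch (α - l) l * w h l * momFun α p (-((l : ℤ) + 1))))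

/-- The bilinear form `⟨p, q⟩_ξ` (case `α` a positive integer with `α ≤ max G`). -/
noncomputable def bilinXi (α : ℕ) {m : ℕ} (g : Fin m → ℕ) (κ : ℕ → Fin m → ℝ)
    (w : Fin m → ℕ → ℝ) (p q : Polynomial ℝ) : ℝ :=
  momFun ((α - m : ℕ) : ℝ) (p * Polynomial.derivative^[m - α] q) 0 +
    ∑ i ∈ Finset.range m,
      (Polynomial.eval 0 (Polynomial.derivative^[i] q) / (Nat.factorial i : ℝ)) *
        (∑ h : Fin m,
          (poch ((i : ℝ) - m + α + 1) (m - α) * (-(1 / (m : ℝ))) * momFun α p ((i : ℤ) - (m : ℤ)) +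
            κ i h * ∑ l ∈ Finset.range (if g h < α then g h + 1 else α),
              poch ((α : ℝ) - l) l * w h l * momFun α p (-((l : ℤ) + 1)))) +
    Real.Gamma α *
      ∑ i ∈ Finset.range m,
        (Polynomial.eval 0 (Polynomial.derivative^[i] q) / (Nat.factorial i : ℝ)) *
          ∑ h ∈ Finset.univ.filter (fun h : Fin m => α ≤ g h),
            κ i h *
              ∑ j ∈ Finset.range (g h - α + 1),
                (Polynomial.eval 0 (Polynomial.derivative^[j] p) / (Nat.factorial j : ℝ)) *
                  ∑ l ∈ Finset.Icc (α + j) (g h), poch ((α : ℝ) - l) j * w h l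


/-- The cofactors. -/
noncomputable def betaC {m : ℕ} (R : Fin m → Polynomial ℝ) (x : ℝ) (j : Fin (m + 1)) : ℝ :=
  (-1) ^ (j : ℕ) * Matrix.det (Matrix.of fun l k : Fin m =>
    (R l).eval (x - (((j.succAbove k : Fin (m + 1)) : ℕ) : ℝ)))

lemma qpoly_eq (α : ℝ) {m : ℕ} (R : Fin m → Polynomial ℝ) (n : ℤ) :
    qpoly α R n = ∑ j : Fin (m + 1), C (betaC R n j) * laguerreZ α (n - (j : ℕ)) := by
  unfold qpoly
  rw [Matrix.det_succ_row_zero]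
  refine Finset.sum_congr rfl fun j _ => ?_
  have : Matrix.det ((Matrix.of fun i j : Fin (m + 1) =>
    if h : (i : ℕ) = 0 then laguerreZ α (n - (j : ℕ))
    else Polynomial.C ((R ⟨(i : ℕ) - 1, by have := i.isLt; omega⟩).eval
      ((n : ℝ) - ((j : ℕ) : ℝ)))).submatrix Fin.succ j.succAbove)
      = C (Matrix.det (Matrix.of fun l k : Fin m =>
    (R l).eval ((n : ℝ) - (((j.succAbove k : Fin (m + 1)) : ℕ) : ℝ)))) := by
    rw [RingHom.map_det]
    congr 1
  rw [this]
  simp only [Matrix.of_apply, betaC, C_mul, C_pow, C_neg, C_1]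
  rw [dif_pos (by simp)]
  ring

lemma beta_sum {m : ℕ} (R : Fin m → Polynomial ℝ) (x : ℝ) (h : Fin m) :
    ∑ j : Fin (m + 1), betaC R x j * (R h).eval (x - (j : ℕ)) = 0 := by
  let M : Matrix (Fin (m + 1)) (Fin (m + 1)) ℝ := Matrix.of fun i j =>
    (R (Fin.cons (α := fun _ => Fin m) h id i)).eval (x - (j : ℕ))
  have h0 : M.det = 0 := by
    apply Matrix.det_zero_of_row_eq (i := 0) (j := h.succ) (Fin.succ_ne_zero h).symm
    ext j
    simp [M]
  rw [Matrix.det_succ_row_zero] at h0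
  rw [← h0]
  refine Finset.sum_congr rfl fun j _ => ?_
  have : (M.submatrix Fin.succ j.succAbove) = Matrix.of fun l k : Fin m =>
    (R l).eval (x - (((j.succAbove k : Fin (m + 1)) : ℕ) : ℝ)) := by
    ext a b; simp [M]
  rw [this, betaC]
  simp [M]; ring

lemma beta_zero {m : ℕ} (R : Fin m → Polynomial ℝ) (x : ℝ) :
    betaC R x 0 = casoratian R x := by
  simp [betaC, casoratian]

lemma span_lemma {m : ℕ} (R : Fin m → Polynomial ℝ)
    (hΩ : ∀ n : ℕ, casoratian R (n : ℝ) ≠ 0) (s : ℕ → ℝ) (N : ℕ) (hN : m ≤ N)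
    (hs : ∀ n, N ≤ n → ∑ j : Fin (m + 1), betaC R n j * s (n - (j : ℕ)) = 0) :
    ∃ c : Fin m → ℝ, ∀ n, N - m ≤ n → s n = (∑ h, C (c h) * R h).eval (n : ℝ) := by
  let A : Matrix (Fin m) (Fin m) ℝ := Matrix.of fun l j => (R l).eval ((N : ℝ) - ((j : ℕ) + 1))
  have hA : IsUnit A.det := isUnit_iff_ne_zero.2 (hΩ N)
  let v : Fin m → ℝ := fun j => s (N - ((j : ℕ) + 1))
  refine ⟨Matrix.vecMul v A⁻¹, ?_⟩
  have hc : Matrix.vecMul (Matrix.vecMul v A⁻¹) A = v := by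
    rw [Matrix.vecMul_vecMul, Matrix.nonsing_inv_mul _ hA, Matrix.vecMul_one]
  generalize Matrix.vecMul v A⁻¹ = c at hc
  have h1 : ∀ n, N - m ≤ n → n < N → s n = (∑ h, C (c h) * R h).eval (n : ℝ) := by
    intro n hn hn'
    have := congrFun hc ⟨N - 1 - n, by omega⟩
    simp only [v, Matrix.vecMul, dotProduct, A, Matrix.of_apply] at this
    have e : N - (N - 1 - n + 1) = n := by omega
    rw [e] at this
    rw [← this, eval_finsetSum]
    refine Finset.sum_congr rfl fun h _ => ?_
    have e2 : (N : ℝ) = n + ((N - 1 - n : ℕ) + 1 : ℝ) := by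
      have : N = n + ((N - 1 - n) + 1) := by omega
      exact_mod_cast this
    rw [eval_mul, eval_C]
    congr 2
    linarith
  intro n
  induction n using Nat.strong_induction_on with
  | _ n ih =>
    intro hn
    rcases lt_or_ge n N with hlt | hge
    · exact h1 n hn hlt
    · have e1 := hs n hge
      have e2 : ∑ j : Fin (m + 1), betaC R n j * (∑ h, C (c h) * R h).eval ((n : ℝ) - (j : ℕ)) = 0 := by
        simp only [eval_finsetSum, eval_mul, eval_C, Finset.mul_sum]
        rw [Finset.sum_comm]
        refine Finset.sum_eq_zero fun h _ => ?_
        have := beta_sum R n h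
        rw [← mul_zero (c h), ← this, Finset.mul_sum]
        exact Finset.sum_congr rfl fun j _ => by ring
      rw [Fin.sum_univ_succ] at e1 e2
      have e3 : ∀ j : Fin m, s (n - (j.succ : ℕ)) =
          (∑ h, C (c h) * R h).eval ((n : ℝ) - (j.succ : ℕ)) := by
        intro j
        have hj := j.isLt
        have := ih (n - (j.succ : ℕ)) (by simp; omega) (by simp; omega)
        rw [this, Nat.cast_sub (by simp; omega)]
      simp only [e3] at e1
      have e4 : betaC R n 0 * s n = betaC R n 0 * (∑ h, C (c h) * R h).eval (n : ℝ) := by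
        simp only [Fin.val_zero, Nat.sub_zero, Nat.cast_zero, sub_zero] at e1 e2
        linarith
      refine mul_left_cancel₀ ?_ e4
      rw [beta_zero]; exact hΩ n

lemma not_const {m : ℕ} (g : Fin m → ℕ) (hg : StrictMono g)
    (hgpos : ∀ i, 0 < g i) (R : Fin m → Polynomial ℝ)
    (hdeg : ∀ i, (R i).natDegree = g i)
    (hlead : ∀ i, (R i).leadingCoeff = 1 / (Nat.factorial (g i) : ℝ))
    (c : Fin m → ℝ) (k : ℝ) (h : ∑ h, C (c h) * R h = C k) : k = 0 := by
  by_cases hc : ∀ i, c i = 0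
  · simp [hc] at h
    exact C_eq_zero.1 h.symm
  · push Not at hc
    exfalso
    have hne : (Finset.univ.filter (fun i => c i ≠ 0)).Nonempty := by
      obtain ⟨i, hi⟩ := hc
      exact ⟨i, by simpa using hi⟩
    obtain ⟨i, hi, hmax⟩ := Finset.exists_max_image _ g hne
    simp only [Finset.mem_filter, Finset.mem_univ, true_and] at hi hmax
    have h2 := congrArg (fun p => p.coeff (g i)) h
    simp only [finsetSum_coeff, coeff_C_mul, coeff_C, (hgpos i).ne', if_false] at h2
    rw [Finset.sum_eq_single i] at h2
    · have h3 : (R i).coeff (g i) = 1 / (Nat.factorial (g i) : ℝ) := by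
        rw [← hlead, leadingCoeff, hdeg]
      rw [h3] at h2
      have : (Nat.factorial (g i) : ℝ) ≠ 0 := by positivity
      simp [hi, this] at h2
    · intro j _ hj
      by_cases hcj : c j = 0
      · simp [hcj]
      · have := hmax j hcj
        have h5 : g j ≠ g i := fun e => hj (hg.injective e)
        rw [coeff_eq_zero_of_natDegree_lt, mul_zero]
        rw [hdeg]; omega
    · simp

/-- The difference operator. -/
noncomputable def Dop (α : ℝ) : Polynomial ℝ →ₗ[ℝ] Polynomial ℝ where
  toFun S := -(X + 1) * S.comp (X + 1) + (2 * X + C (α + 1)) * S - (X + C α) * S.comp (X - 1)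
  map_add' p q := by simp only [add_comp]; ring
  map_smul' r p := by simp only [RingHom.id_apply, smul_eq_C_mul, mul_comp, C_comp]; ring

lemma binomPoly_succ (k : ℕ) : C ((k : ℝ) + 1) * binomPoly (k + 1) =
    binomPoly k * (X + C ((k : ℝ) + 1)) := by
  unfold binomPoly
  rw [Finset.prod_range_succ, ← mul_assoc, ← C_mul, ← mul_assoc]
  congr 3
  rw [Nat.factorial_succ]
  push_cast
  field_simp

lemma binomPoly_shift (k : ℕ) : (X + C (1 : ℝ)) * (binomPoly k).comp (X + 1) =
    (X + C ((k : ℝ) + 1)) * binomPoly k := by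
  induction k with
  | zero => simp [binomPoly]
  | succ k ih =>
    have h := congrArg (fun p => p.comp (X + 1)) (binomPoly_succ k)
    simp only [mul_comp, C_comp, add_comp, X_comp] at h
    have hk : C ((k : ℝ) + 1) ≠ 0 := by
      rw [Ne, C_eq_zero]; positivity
    apply mul_left_cancel₀ hk
    have h2 := binomPoly_succ k
    simp only [C_add, C_1, Nat.cast_add, Nat.cast_one] at *
    linear_combination (X + 1) * h + (X + 1 + (C (k : ℝ) + 1)) * ih - (X + (C (k:ℝ) + 1 + 1)) * h2

lemma Dop_zero (α : ℝ) : Dop α (binomPoly 0) = 0 := by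
  simp [Dop, binomPoly]; ring

lemma Dop_succ (α : ℝ) (k : ℕ) :
    Dop α (binomPoly (k + 1)) = C (α - (k + 1)) * binomPoly k := by
  have h1 := binomPoly_shift (k + 1)
  have h2 := binomPoly_succ k
  have h3 : C ((k : ℝ) + 1) * (binomPoly (k + 1)).comp (X - 1) = X * binomPoly k := by
    have a := congrArg (fun p => p.comp (X - 1)) h2
    have b := congrArg (fun p => p.comp (X - 1)) (binomPoly_shift k)
    simp only [mul_comp, C_comp, add_comp, X_comp, comp_assoc, one_comp, sub_add_cancel, comp_X,
      C_1] at a b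
    rw [a, mul_comm, ← b]
  have hk : C ((k : ℝ) + 1) ≠ 0 := by
    rw [Ne, C_eq_zero]; positivity
  apply mul_left_cancel₀ hk
  simp only [Dop, LinearMap.coe_mk, AddHom.coe_mk]
  simp only [C_add, C_1, C_sub, Nat.cast_add, Nat.cast_one] at *
  linear_combination (-(C (k:ℝ) + 1)) * h1 - (X + C α) * h3 + (X + C α - C (k:ℝ) - 1) * h2

lemma Dop_pow_binom (α : ℝ) (d : ℕ) :
    ((Dop α) ^ d) (binomPoly d) = C (∏ k ∈ Finset.range d, (α - (k + 1))) := by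
  induction d with
  | zero => simp [binomPoly]
  | succ d ih =>
    rw [pow_succ, Module.End.mul_apply, Dop_succ, ← smul_eq_C_mul, map_smul, ih,
      smul_eq_C_mul, ← C_mul, Finset.prod_range_succ, mul_comm]

lemma Dop_pow_binom_succ (α : ℝ) (d : ℕ) : ((Dop α) ^ (d + 1)) (binomPoly d) = 0 := by
  have h : (1 : ℝ[X]) = binomPoly 0 := by simp [binomPoly]
  rw [pow_succ', Module.End.mul_apply, Dop_pow_binom, ← mul_one (C _), ← smul_eq_C_mul, map_smul, h,
    Dop_zero, smul_zero]

lemma binomPoly_natDegree (d : ℕ) : (binomPoly d).natDegree = d := by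
  unfold binomPoly
  rw [natDegree_C_mul (by positivity), natDegree_prod_of_monic _ _ (fun i _ => monic_X_add_C _)]
  simp only [natDegree_X_add_C]
  simp

lemma binomPoly_ne (d : ℕ) : binomPoly d ≠ 0 := by
  unfold binomPoly
  refine mul_ne_zero (by rw [Ne, C_eq_zero]; positivity) ?_
  exact (monic_prod_of_monic _ _ (fun i _ => monic_X_add_C _)).ne_zero

lemma binomPoly_coeff (d : ℕ) : (binomPoly d).coeff d ≠ 0 := by
  have := leadingCoeff_ne_zero.2 (binomPoly_ne d)
  rwa [leadingCoeff, binomPoly_natDegree] at this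

lemma binom_split (d : ℕ) (S : ℝ[X]) (hS : S.degree < ((d + 1 : ℕ) : WithBot ℕ)) :
    ∃ c : ℝ, ∃ S' : ℝ[X], S = C c * binomPoly d + S' ∧ S'.degree < (d : WithBot ℕ) ∧
      c * (binomPoly d).coeff d = S.coeff d := by
  refine ⟨S.coeff d / (binomPoly d).coeff d, S - C (S.coeff d / (binomPoly d).coeff d) * binomPoly d,
    by ring, ?_, div_mul_cancel₀ _ (binomPoly_coeff d)⟩
  rw [degree_lt_iff_coeff_zero] at hS ⊢
  intro k hk
  rcases hk.eq_or_lt with rfl | hk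
  · simp [div_mul_cancel₀ _ (binomPoly_coeff d)]
  · rw [coeff_sub, coeff_C_mul, hS k hk,
      coeff_eq_zero_of_natDegree_lt (p := binomPoly d) (n := k) (by rw [binomPoly_natDegree]; exact hk)]
    simp

lemma Dop_pow_lt (α : ℝ) (d : ℕ) : ∀ S : ℝ[X], S.degree < (d : WithBot ℕ) →
    ((Dop α) ^ d) S = 0 := by
  induction d with
  | zero =>
    intro S hS
    have : S = 0 := by
      rw [← degree_eq_bot]
      simpa using hS
    simp [this]
  | succ d ih =>
    intro S hS
    obtain ⟨c, S', rfl, h', -⟩ := binom_split d S hS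
    rw [map_add, ← smul_eq_C_mul, map_smul, Dop_pow_binom_succ, pow_succ', Module.End.mul_apply,
      ih S' h']
    simp

lemma Dop_pow_natDegree (α : ℝ) (S : ℝ[X]) (hS : S ≠ 0)
    (hα : ∀ k : ℕ, 1 ≤ k → k ≤ S.natDegree → α ≠ k) :
    ∃ k : ℝ, k ≠ 0 ∧ ((Dop α) ^ S.natDegree) S = C k := by
  obtain ⟨c, S', h1, h2, h3⟩ := binom_split S.natDegree S
    (by rw [degree_eq_natDegree hS]; exact_mod_cast Nat.lt_succ_self _)
  have hc : c ≠ 0 := by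
    rintro rfl
    rw [zero_mul] at h3
    exact hS (leadingCoeff_eq_zero.1 h3.symm)
  refine ⟨c * ∏ k ∈ Finset.range S.natDegree, (α - (k + 1)), mul_ne_zero hc ?_, ?_⟩
  · refine Finset.prod_ne_zero_iff.2 fun k hk => sub_ne_zero.2 ?_
    have := hα (k + 1) (by omega) (by simpa using hk)
    exact_mod_cast this
  · generalize S.natDegree = d at *
    rw [h1, map_add, ← smul_eq_C_mul, map_smul, Dop_pow_binom, Dop_pow_lt α d S' h2, smul_eq_C_mul,
      C_mul, add_zero]

lemma laguerre_coeff (α : ℝ) (n j : ℕ) : (laguerre α n).coeff j =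
    if j ≤ n then (-1 : ℝ) ^ j / (Nat.factorial j : ℝ) * genBinom α n j else 0 := by
  unfold laguerre
  simp only [finsetSum_coeff, coeff_C_mul, coeff_X_pow, mul_ite, mul_one, mul_zero]
  rw [Finset.sum_ite_eq]
  simp

lemma genBinom_self (α : ℝ) (n : ℕ) : genBinom α n n = 1 := by simp [genBinom]

lemma genBinom_succ_left (α : ℝ) (n j : ℕ) (h : j ≤ n) :
    ((n : ℝ) - j + 1) * genBinom α (n + 1) j = (α + n + 1) * genBinom α n j := by
  obtain ⟨k, rfl⟩ := Nat.exists_eq_add_of_le h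
  unfold genBinom
  rw [Finset.prod_Ico_succ_top (by omega)]
  have e1 : j + k + 1 - j = k + 1 := by omega
  have e2 : j + k - j = k := by omega
  rw [e1, e2, Nat.factorial_succ]
  push_cast
  have : (k : ℝ) + 1 ≠ 0 := by positivity
  have e3 : (j : ℝ) + k - j + 1 = k + 1 := by ring
  rw [e3]
  field_simp
  ring

lemma genBinom_succ_right (α : ℝ) (n j : ℕ) (h : j + 1 ≤ n) :
    ((n : ℝ) - j) * genBinom α n j = (α + j + 1) * genBinom α n (j + 1) := by
  obtain ⟨k, rfl⟩ := Nat.exists_eq_add_of_le h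
  unfold genBinom
  rw [Finset.prod_eq_prod_Ico_succ_bot (by omega)]
  have e1 : j + 1 + k - j = k + 1 := by omega
  have e2 : j + 1 + k - (j + 1) = k := by omega
  rw [e1, e2, Nat.factorial_succ]
  push_cast
  have : (k : ℝ) + 1 ≠ 0 := by positivity
  have e3 : (j : ℝ) + 1 + k - j = k + 1 := by ring
  rw [e3]
  field_simp
  ring

lemma laguerre_rec (α : ℝ) (n : ℕ) : X * laguerre α (n + 1) =
    -C ((n : ℝ) + 2) * laguerre α (n + 2) + C (2 * ((n : ℝ) + 1) + α + 1) * laguerre α (n + 1)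
      - C ((n : ℝ) + 1 + α) * laguerre α n := by
  ext j
  rw [← C_neg]
  simp only [coeff_sub, coeff_add, coeff_C_mul]
  rcases j with _ | j
  · rw [coeff_X_mul_zero]
    simp only [laguerre_coeff]
    have h1 := genBinom_succ_left α n 0 (by omega)
    have h2 := genBinom_succ_left α (n + 1) 0 (by omega)
    simp only [Nat.zero_le, if_true]
    push_cast at *
    simp
    linear_combination h2 - h1
  · rw [coeff_X_mul]
    simp only [laguerre_coeff]
    have hf : (Nat.factorial j : ℝ) ≠ 0 := by positivity
    have hj : (j : ℝ) + 1 ≠ 0 := by positivity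
    rcases lt_trichotomy (n + 1) j with h | h | h
    · rw [if_neg (by omega), if_neg (by omega), if_neg (by omega), if_neg (by omega)]; simp
    · subst h
      rw [if_pos (by omega), if_pos (by omega), if_neg (by omega), if_neg (by omega)]
      simp only [genBinom_self, Nat.factorial_succ, pow_succ]
      push_cast at *
      field_simp
      ring
    · rcases Nat.lt_or_ge j n with h' | h'
      · rw [if_pos (by omega), if_pos (by omega), if_pos (by omega), if_pos (by omega)]
        have h1 := genBinom_succ_left α n (j + 1) (by omega)
        have h2 := genBinom_succ_left α (n + 1) (j + 1) (by omega)
        have h3 := genBinom_succ_right α (n + 1) j (by omega)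
        have h4 : (n : ℝ) + 1 - j ≠ 0 := by
          have : (j : ℝ) < n := by exact_mod_cast h'
          linarith
        rw [Nat.factorial_succ, pow_succ]
        push_cast at *
        have h5 : (j + 1) * genBinom α (n + 1) j = (n + 2) * genBinom α (n + 2) (j + 1)
          - (2 * (n + 1) + α + 1) * genBinom α (n + 1) (j + 1)
          + (n + 1 + α) * genBinom α n (j + 1) := by
          apply mul_left_cancel₀ h4
          linear_combination (j + 1) * h3 - (n + 2) * h2 + (n + 1 - j) * h1
        field_simp
        linear_combination h5
      · obtain rfl : j = n := by omega
        rw [if_pos (by omega), if_pos (by omega), if_pos (by omega), if_neg (by omega)]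
        have h2 := genBinom_succ_left α (j + 1) (j + 1) (by omega)
        have h3 := genBinom_succ_right α (j + 1) j (by omega)
        rw [genBinom_self] at *
        rw [Nat.factorial_succ, pow_succ]
        push_cast at *
        have h3' : genBinom α (j + 1) j = α + j + 1 := by linear_combination h3
        have h2' : genBinom α (j + 1 + 1) (j + 1) = α + j + 2 := by linear_combination h2
        rw [h3']
        rw [h2']
        field_simp
        ring

lemma laguerre_natDegree_le (α : ℝ) (n : ℕ) : (laguerre α n).natDegree ≤ n := by
  rw [natDegree_le_iff_coeff_eq_zero]
  intro k hk
  rw [laguerre_coeff, if_neg (by omega)]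

lemma laguerre_coeff_self (α : ℝ) (n : ℕ) : (laguerre α n).coeff n ≠ 0 := by
  rw [laguerre_coeff, if_pos le_rfl, genBinom_self]
  have : (Nat.factorial n : ℝ) ≠ 0 := by positivity
  simp [this]

lemma qpoly_degree (α : ℝ) {m : ℕ} (R : Fin m → Polynomial ℝ)
    (hΩ : ∀ n : ℕ, casoratian R (n : ℝ) ≠ 0) (n : ℕ) :
    (qpoly α R (n : ℤ)).degree = n := by
  have hz : ∀ j : ℕ, ∀ k : ℕ, n < k + j → (laguerreZ α ((n : ℤ) - j)).coeff k = 0 := by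
    intro j k hk
    unfold laguerreZ
    split_ifs with h
    · simp
    · rw [laguerre_coeff, if_neg (by omega)]
  have hd : (qpoly α R (n : ℤ)).natDegree ≤ n := by
    rw [natDegree_le_iff_coeff_eq_zero]
    intro k hk
    rw [qpoly_eq, finsetSum_coeff]
    refine Finset.sum_eq_zero fun j _ => ?_
    rw [coeff_C_mul, hz j k (by omega), mul_zero]
  have hc : (qpoly α R (n : ℤ)).coeff n ≠ 0 := by
    rw [qpoly_eq, finsetSum_coeff, Fin.sum_univ_succ, Finset.sum_eq_zero, add_zero, coeff_C_mul]
    · rw [beta_zero]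
      refine mul_ne_zero (by exact_mod_cast hΩ n) ?_
      have e : laguerreZ α ((n : ℤ) - ((0 : Fin (m + 1)) : ℕ)) = laguerre α n := by
        unfold laguerreZ
        rw [if_neg (by simp)]
        simp
      rw [e]
      exact laguerre_coeff_self α n
    · intro j _
      rw [coeff_C_mul, hz _ n (by simp), mul_zero]
  exact degree_eq_of_le_of_coeff_ne_zero (natDegree_le_iff_degree_le.1 hd) hc

/-- `(q_n)_n` never satisfies a three-term recurrence relation
`x·q_n = a_n q_{n+1} + b_n q_n + c_n q_{n−1}` with `c_n ≠ 0` for `n ≥ 1`. -/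
theorem statement2 (α : ℝ) (m : ℕ) (hm : 0 < m) (g : Fin m → ℕ) (hg : StrictMono g)
    (hgpos : ∀ i, 0 < g i) (R : Fin m → Polynomial ℝ)
    (hdeg : ∀ i, (R i).natDegree = g i)
    (hlead : ∀ i, (R i).leadingCoeff = 1 / (Nat.factorial (g i) : ℝ))
    (hα : ∀ k : ℕ, α - (Gmax g : ℝ) ≠ -(k : ℝ))
    (hΩ : ∀ n : ℕ, casoratian R (n : ℝ) ≠ 0) :
    ¬ ∃ a b c : ℕ → ℝ, (∀ n : ℕ, 1 ≤ n → c n ≠ 0) ∧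
        (∀ n : ℕ, Polynomial.X * qZ α R (n : ℤ) =
          Polynomial.C (a n) * qZ α R ((n : ℤ) + 1) + Polynomial.C (b n) * qZ α R (n : ℤ) +
            Polynomial.C (c n) * qZ α R ((n : ℤ) - 1)) := by
  rintro ⟨a, b, c, -, hrec⟩
  -- the dual functional
  let Q : Polynomial.Sequence ℝ := ⟨fun n => qpoly α R (n : ℤ), fun n => qpoly_degree α R hΩ n⟩
  have hunit : ∀ i, IsUnit (Q i).leadingCoeff := fun i =>
    isUnit_iff_ne_zero.2 (leadingCoeff_ne_zero.2 (Q.ne_zero i))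
  let u : ℝ[X] →ₗ[ℝ] ℝ := (Q.basis hunit).coord 0
  have hQ : ∀ n : ℕ, u (qpoly α R (n : ℤ)) = if n = 0 then 1 else 0 := by
    intro n
    have : qpoly α R (n : ℤ) = Q.basis hunit n := (Q.basis_eq_self hunit n).symm
    rw [this]
    simp only [u, Module.Basis.coord_apply, Module.Basis.repr_self, Finsupp.single_apply]
  have hrec' : ∀ n : ℕ, X * qpoly α R ((n + 1 : ℕ) : ℤ) =
      C (a (n + 1)) * qpoly α R ((n + 2 : ℕ) : ℤ) + C (b (n + 1)) * qpoly α R ((n + 1 : ℕ) : ℤ) +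
        C (c (n + 1)) * qpoly α R (n : ℤ) := by
    intro n
    have h := hrec (n + 1)
    have e1 : (((n + 1 : ℕ) : ℤ) + 1) = ((n + 2 : ℕ) : ℤ) := by push_cast; ring
    have e2 : (((n + 1 : ℕ) : ℤ) - 1) = (n : ℤ) := by push_cast; ring
    rw [e1, e2] at h
    simpa only [qZ, if_neg (not_lt.2 (Int.natCast_nonneg _))] using h
  have horth : ∀ i n : ℕ, i < n → u (X ^ i * qpoly α R (n : ℤ)) = 0 := by
    intro i
    induction i with
    | zero => intro n hn; simp [hQ, hn.ne']
    | succ i ih =>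
      intro n hn
      obtain ⟨n, rfl⟩ : ∃ k, n = k + 1 := ⟨n - 1, by omega⟩
      have : X ^ (i + 1) * qpoly α R ((n + 1 : ℕ) : ℤ) =
          a (n + 1) • (X ^ i * qpoly α R ((n + 2 : ℕ) : ℤ)) +
          b (n + 1) • (X ^ i * qpoly α R ((n + 1 : ℕ) : ℤ)) +
          c (n + 1) • (X ^ i * qpoly α R (n : ℤ)) := by
        rw [pow_succ, mul_assoc, hrec']
        simp only [smul_eq_C_mul]
        ring
      rw [this, map_add, map_add, map_smul, map_smul, map_smul, ih _ (by omega), ih _ (by omega),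
        ih _ (by omega)]
      simp
  have hspan : ∀ i N : ℕ, m ≤ N → i < N → ∃ c : Fin m → ℝ, ∀ n, N - m ≤ n →
      u (X ^ i * laguerre α n) = (∑ h, C (c h) * R h).eval (n : ℝ) := by
    intro i N hN hi
    refine span_lemma R hΩ (fun n => u (X ^ i * laguerre α n)) N hN fun n hn => ?_
    rw [← horth i n (by omega), qpoly_eq, Finset.mul_sum, map_sum]
    refine Finset.sum_congr rfl fun j _ => ?_
    have hj := j.isLt
    have e : laguerreZ α ((n : ℤ) - (j : ℕ)) = laguerre α (n - (j : ℕ)) := by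
      unfold laguerreZ
      rw [if_neg (by omega)]
      congr 1
      omega
    rw [e, mul_left_comm, ← smul_eq_C_mul, map_smul, smul_eq_mul]
    simp
  obtain ⟨c0, h0⟩ := hspan 0 m le_rfl hm
  set S : ℝ[X] := ∑ h, C (c0 h) * R h with hSdef
  simp only [Nat.sub_self, Nat.zero_le, forall_const, pow_zero, one_mul] at h0
  have hS : S ≠ 0 := by
    intro hS
    have h1 := hQ 0
    rw [qpoly_eq, map_sum, Finset.sum_eq_zero] at h1
    · simp at h1
    · intro j _
      rw [← smul_eq_C_mul, map_smul]
      unfold laguerreZ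
      split_ifs
      · simp
      · rw [h0, hS]; simp
  have hSd : S.natDegree ≤ Gmax g := by
    refine natDegree_sum_le_of_forall_le _ _ fun i _ => ?_
    refine (natDegree_C_mul_le _ _).trans ?_
    rw [hdeg]
    exact Finset.le_sup (f := g) (Finset.mem_univ i)
  have hD : ∀ i n : ℕ, i ≤ n → u (X ^ i * laguerre α n) = (((Dop α) ^ i) S).eval (n : ℝ) := by
    intro i
    induction i with
    | zero => intro n _; simp [h0]
    | succ i ih =>
      intro n hn
      obtain ⟨n, rfl⟩ : ∃ k, n = k + 1 := ⟨n - 1, by omega⟩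
      have : X ^ (i + 1) * laguerre α (n + 1) =
          (-((n : ℝ) + 2)) • (X ^ i * laguerre α (n + 2)) +
          (2 * ((n : ℝ) + 1) + α + 1) • (X ^ i * laguerre α (n + 1)) -
          ((n : ℝ) + 1 + α) • (X ^ i * laguerre α n) := by
        rw [pow_succ, mul_assoc, laguerre_rec]
        simp only [smul_eq_C_mul, C_neg]
        ring
      rw [this, map_sub, map_add, map_smul, map_smul, map_smul, ih _ (by omega), ih _ (by omega),
        ih _ (by omega), pow_succ', Module.End.mul_apply]
      generalize (Dop α ^ i) S = T
      simp only [Dop, LinearMap.coe_mk, AddHom.coe_mk, smul_eq_mul, eval_sub, eval_add, eval_mul,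
        eval_neg, eval_X, eval_C, eval_comp, eval_one, eval_ofNat]
      have e1 : (((n + 1 : ℕ) : ℝ) + 1) = ((n + 2 : ℕ) : ℝ) := by push_cast; ring
      have e2 : (((n + 1 : ℕ) : ℝ) - 1) = (n : ℝ) := by push_cast; ring
      rw [e1, e2]
      push_cast
      ring
  obtain ⟨k, hk, hDk⟩ := Dop_pow_natDegree α S hS (by
    intro k _ hk2 hk3
    apply hα (Gmax g - k)
    rw [Nat.cast_sub (by omega), hk3]
    ring)
  obtain ⟨c1, h1⟩ := hspan S.natDegree (m + S.natDegree + 1) (by omega) (by omega)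
  apply hk
  refine not_const g hg hgpos R hdeg hlead c1 k ?_
  refine eq_of_infinite_eval_eq _ _ ?_
  refine Set.Infinite.mono (s := (fun n : ℕ => (n : ℝ)) '' Set.Ici (S.natDegree + 1)) ?_ ?_
  · rintro _ ⟨n, hn, rfl⟩
    have hn' : S.natDegree + 1 ≤ n := hn
    have e := h1 n (by omega)
    rw [hD _ n (by omega), hDk] at e
    exact e.symm
  · exact (Set.Ici_infinite _).image (Nat.cast_injective.injOn)
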